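/- Let N be a contact-free (1-safe) Petri net with place out-degree at most one. Then sequential reachability from Init is confluent: for every sequentially reachable marking M0 and markings M1, M2 reachable from M0 by firing sequences, there exists a marking M3 reachable from M1 by a firing sequence and reachable from M2 by a firing sequence. -/

import Mathlib

/-- A (1-bounded) Petri net with places `P` and transitions `T`. -/
structure PetriNet (P T : Type*) where
  pre : T → Set P
  post : T → Set P
  pre_fin : ∀ t, (pre t).Finite
  pre_ne : ∀ t, (pre t).Nonempty
  post_fin : ∀ t, (post t).Finite
  post_ne : ∀ t, (post t).Nonempty
  Init : Set P

namespace PetriNet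

variable {P T : Type*} (N : PetriNet P T)

/-- A transition `t` is enabled at marking `M` if its preset is contained in `M`. -/
def Enabled (M : Set P) (t : T) : Prop := N.pre t ⊆ M

/-- Firing transition `t` at marking `M` yields `(M \ pre t) ∪ post t`. -/
def fire (M : Set P) (t : T) : Set P := (M \ N.pre t) ∪ N.post t

/-- The firing of `t` at `M` is contact-free if `post t ∩ (M \ pre t) = ∅`. -/
def ContactFreeAt (M : Set P) (t : T) : Prop := N.post t ∩ (M \ N.pre t) = ∅

/-- `FiresTo N M l M'` : the firing sequence `l` can be fired successively from `M`,
reaching `M'`. -/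
inductive FiresTo : Set P → List T → Set P → Prop
  | nil (M : Set P) : FiresTo M [] M
  | cons {M M' : Set P} {t : T} {l : List T} :
      N.Enabled M t → FiresTo (N.fire M t) l M' → FiresTo M (t :: l) M'

/-- The set of sequentially reachable markings. -/
def ReachSeq : Set (Set P) := {M | ∃ l : List T, N.FiresTo N.Init l M}

/-- The net is contact-free (1-safe): every firing of an enabled transition at a
sequentially reachable marking is contact-free. -/
def ContactFreeNet : Prop :=
  ∀ M ∈ N.ReachSeq, ∀ t : T, N.Enabled M t → N.ContactFreeAt M t

/-- `U` is a nonempty finite set of transitions that are all enabled at `M`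
and have pairwise disjoint presets. -/
def ConcEnabled (M : Set P) (U : Set T) : Prop :=
  U.Nonempty ∧ U.Finite ∧ (∀ t ∈ U, N.Enabled M t) ∧
    (∀ t1 ∈ U, ∀ t2 ∈ U, t1 ≠ t2 → N.pre t1 ∩ N.pre t2 = ∅)

/-- The result of the concurrent step firing the set `U` at `M`. -/
def concFire (M : Set P) (U : Set T) : Set P :=
  (M \ ⋃ t ∈ U, N.pre t) ∪ ⋃ t ∈ U, N.post t

/-- A maximal concurrent step: `U` is maximal among nonempty sets of transitions
enabled at `M` with pairwise disjoint presets, and firing `U` at `M` yields `M'`. -/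
def MaxConcStep (M : Set P) (U : Set T) (M' : Set P) : Prop :=
  N.ConcEnabled M U ∧ (∀ V : Set T, N.ConcEnabled M V → U ⊆ V → V = U) ∧
    M' = N.concFire M U

/-- Reachability by a sequence of maximal concurrent steps
(true concurrent flow semantics). -/
inductive TCFiresTo : Set P → Set P → Prop
  | refl (M : Set P) : TCFiresTo M M
  | step {M M' M'' : Set P} (U : Set T) :
      N.MaxConcStep M U M' → TCFiresTo M' M'' → TCFiresTo M M''

/-- The set of markings reachable under the true concurrent flow semantics. -/
def ReachTC : Set (Set P) := {M | N.TCFiresTo N.Init M}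

/-- The net has place out-degree at most one: each place has at most one
outgoing transition. -/
def OutDegOne : Prop := ∀ p : P, ∀ t1 t2 : T, p ∈ N.pre t1 → p ∈ N.pre t2 → t1 = t2

end PetriNet

namespace PetriNet

variable {P T : Type*} {N : PetriNet P T}

theorem FiresTo.append {M M' M'' : Set P} {l l' : List T}
    (h : N.FiresTo M l M') (h' : N.FiresTo M' l' M'') : N.FiresTo M (l ++ l') M'' := by
  induction h with
  | nil M => exact h'
  | cons he _ ih => exact .cons he (ih h')

theorem FiresTo.singleton {M : Set P} {t : T} (h : N.Enabled M t) :
    N.FiresTo M [t] (N.fire M t) :=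
  .cons h (.nil _)

theorem fire_mem_reachSeq {M : Set P} {t : T} (hM : M ∈ N.ReachSeq) (h : N.Enabled M t) :
    N.fire M t ∈ N.ReachSeq := by
  obtain ⟨l, hl⟩ := hM
  exact ⟨l ++ [t], hl.append (.singleton h)⟩

/-- An enabled transition stays enabled after firing one with a disjoint preset. -/
theorem Enabled.fire {M : Set P} {t u : T} (hu : N.Enabled M u)
    (hd : Disjoint (N.pre t) (N.pre u)) : N.Enabled (N.fire M t) u :=
  fun _ hp => Or.inl ⟨hu hp, fun ht => Set.disjoint_left.1 hd ht hp⟩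

theorem ContactFreeAt.disjoint_post_pre {M : Set P} {t u : T} (ht : N.ContactFreeAt M t)
    (hu : N.Enabled M u) (hd : Disjoint (N.pre t) (N.pre u)) :
    Disjoint (N.post t) (N.pre u) :=
  (Set.disjoint_iff_inter_eq_empty.2 ht).mono_right (Set.subset_sdiff.2 ⟨hu, hd.symm⟩)

theorem fire_comm {M : Set P} {t u : T} (htu : Disjoint (N.post t) (N.pre u))
    (hut : Disjoint (N.post u) (N.pre t)) :
    N.fire (N.fire M t) u = N.fire (N.fire M u) t := by
  ext p
  have h₁ : p ∈ N.post t → p ∉ N.pre u := fun h => Set.disjoint_left.1 htu h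
  have h₂ : p ∈ N.post u → p ∉ N.pre t := fun h => Set.disjoint_left.1 hut h
  simp only [PetriNet.fire, Set.mem_union, Set.mem_sdiff]
  tauto

theorem OutDegOne.disjoint_pre (hdeg : N.OutDegOne) {t u : T} (h : t ≠ u) :
    Disjoint (N.pre t) (N.pre u) :=
  Set.disjoint_left.2 fun p ht hu => h (hdeg p t u ht hu)

/-- A single firing from a sequentially reachable marking. -/
def ReachStep (N : PetriNet P T) (M M' : Set P) : Prop :=
  M ∈ N.ReachSeq ∧ ∃ t, N.Enabled M t ∧ M' = N.fire M t

theorem FiresTo.reflTransGen {M M' : Set P} {l : List T} (h : N.FiresTo M l M')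
    (hM : M ∈ N.ReachSeq) : Relation.ReflTransGen N.ReachStep M M' := by
  induction h with
  | nil M => exact .refl
  | cons he _ ih => exact .head ⟨hM, _, he, rfl⟩ (ih (fire_mem_reachSeq hM he))

theorem exists_firesTo_of_reflTransGen {M M' : Set P}
    (h : Relation.ReflTransGen N.ReachStep M M') : ∃ l, N.FiresTo M l M' := by
  induction h with
  | refl => exact ⟨[], .nil _⟩
  | tail _ hs ih =>
    obtain ⟨l, hl⟩ := ih
    obtain ⟨-, t, ht, rfl⟩ := hs
    exact ⟨l ++ [t], hl.append (.singleton ht)⟩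

theorem ReachStep.diamond (hcf : N.ContactFreeNet) (hdeg : N.OutDegOne) {M M₁ M₂ : Set P}
    (h₁ : N.ReachStep M M₁) (h₂ : N.ReachStep M M₂) :
    ∃ M₃, Relation.ReflGen N.ReachStep M₁ M₃ ∧ Relation.ReflTransGen N.ReachStep M₂ M₃ := by
  obtain ⟨hM, t, ht, rfl⟩ := h₁
  obtain ⟨-, u, hu, rfl⟩ := h₂
  by_cases htu : t = u
  · subst htu
    exact ⟨_, .refl, .refl⟩
  · have hd := hdeg.disjoint_pre htu
    refine ⟨N.fire (N.fire M t) u, .single ⟨fire_mem_reachSeq hM ht, u, hu.fire hd, rfl⟩,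
      .single ⟨fire_mem_reachSeq hM hu, t, ht.fire hd.symm, ?_⟩⟩
    exact fire_comm ((hcf M hM t ht).disjoint_post_pre hu hd)
      ((hcf M hM u hu).disjoint_post_pre ht hd.symm)

end PetriNet

/-- in a contact-free net with place out-degree at most one,
sequential reachability from `Init` is confluent. -/
theorem confluence {P T : Type*} (N : PetriNet P T)
    (hcf : N.ContactFreeNet) (hdeg : N.OutDegOne) :
    ∀ M0 ∈ N.ReachSeq, ∀ (M1 M2 : Set P) (l1 l2 : List T),
      N.FiresTo M0 l1 M1 → N.FiresTo M0 l2 M2 →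
      ∃ (M3 : Set P) (l3 l4 : List T),
        N.FiresTo M1 l3 M3 ∧ N.FiresTo M2 l4 M3 := by
  intro M0 hM0 M1 M2 l1 l2 h1 h2
  obtain ⟨M3, h13, h23⟩ := Relation.church_rosser
    (fun _ _ _ => PetriNet.ReachStep.diamond hcf hdeg)
    (h1.reflTransGen hM0) (h2.reflTransGen hM0)
  obtain ⟨l3, hl3⟩ := PetriNet.exists_firesTo_of_reflTransGen h13
  obtain ⟨l4, hl4⟩ := PetriNet.exists_firesTo_of_reflTransGen h23
  exact ⟨M3, l3, l4, hl3, hl4⟩
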